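/- For every ε > 0 and every win condition w ∈ [1/2,1), there exist a finite simple graph G and an initial configuration C_0 on G such that the proportion of vertices of G that are defectors in C_0 is less than ε and C_0 is defector dominant for the w-power index process. -/

import Mathlib

open scoped Classical

/-- A strategy of a voter: collaborator (`C`) or defector (`D`). -/
inductive Strategy : Type
  | C : Strategy
  | D : Strategy
deriving DecidableEq

noncomputable section

variable {V : Type*}

/-- The closed neighbourhood `N[v]` of a vertex, as a finset. -/
def closedNbhd (G : SimpleGraph V) [Fintype V] (v : V) : Finset V :=
  Finset.univ.filter fun u => u = v ∨ G.Adj u v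

/-- The (Shapley–Shubik style) power of a vertex `v` in configuration `c`
with win condition `w`. -/
def power (G : SimpleGraph V) [Fintype V] (w : ℝ) (c : V → Strategy) (v : V) : ℝ :=
  let N := closedNbhd G v
  let nC := (N.filter fun u => c u = Strategy.C).card
  let nD := (N.filter fun u => c u = Strategy.D).card
  match c v with
  | Strategy.C => if w < (nC : ℝ) / (N.card : ℝ) then 1 / (nC : ℝ) else 0
  | Strategy.D => if (nC : ℝ) / (N.card : ℝ) ≤ w then 1 / (nD : ℝ) else 0

/-- One step of the `w`-power index process: every vertex adopts the strategy of a
vertex of maximum power in its closed neighbourhood, retaining its own strategy if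
vertices of maximum power have differing strategies. -/
def step (G : SimpleGraph V) [Fintype V] (w : ℝ) (c : V → Strategy) (v : V) : Strategy :=
  let N := closedNbhd G v
  let M := N.filter fun u => ∀ x ∈ N, power G w c x ≤ power G w c u
  if ∀ u ∈ M, c u = Strategy.C then Strategy.C
  else if ∀ u ∈ M, c u = Strategy.D then Strategy.D
  else c v

/-- `configSeq G w c0 i` is the configuration `C_i` of the `w`-power index process. -/
def configSeq (G : SimpleGraph V) [Fintype V] (w : ℝ) (c0 : V → Strategy) : ℕ → V → Strategy
  | 0 => c0
  | k + 1 => step G w (configSeq G w c0 k)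

/-- The process is eventually stable. -/
def EventuallyStable (G : SimpleGraph V) [Fintype V] (w : ℝ) (c0 : V → Strategy) : Prop :=
  ∃ i, configSeq G w c0 (i + 1) = configSeq G w c0 i

/-- The process reaches a stable all-collaborator configuration. -/
def CollaboratorDominant (G : SimpleGraph V) [Fintype V] (w : ℝ) (c0 : V → Strategy) : Prop :=
  ∃ i, configSeq G w c0 (i + 1) = configSeq G w c0 i ∧
    ∀ v, configSeq G w c0 i v = Strategy.C

/-- The process reaches a stable all-defector configuration. -/
def DefectorDominant (G : SimpleGraph V) [Fintype V] (w : ℝ) (c0 : V → Strategy) : Prop :=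
  ∃ i, configSeq G w c0 (i + 1) = configSeq G w c0 i ∧
    ∀ v, configSeq G w c0 i v = Strategy.D

/-- The process is eventually periodic with period `ℓ`: `ℓ > 1` is the least integer
such that `C_i = C_{i+ℓ}` for some `i ≥ 0`. -/
def EventuallyPeriodicWithPeriod (G : SimpleGraph V) [Fintype V] (w : ℝ)
    (c0 : V → Strategy) (ℓ : ℕ) : Prop :=
  IsLeast {m : ℕ | 1 < m ∧ ∃ i, configSeq G w c0 (i + m) = configSeq G w c0 i} ℓ

end

/-!
The proof does not use the degenerate empty graph: `exists_layered` below builds, for every `n`,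
a graph on at least `n + 2` vertices with a single initial defector that is defector dominant.
The vertices lie in layers `0, …, n + 1`, of sizes `1, 1, 2, 3, …, n, n`; two distinct vertices are
adjacent when their layers differ by at most one. At each step the defectors take one more layer.
-/

/-- Distinct vertices are adjacent when their layers differ by at most one. -/
def layerGraph {V : Type*} (L : V → ℕ) : SimpleGraph V where
  Adj u v := u ≠ v ∧ L u ≤ L v + 1 ∧ L v ≤ L u + 1
  symm := ⟨fun _ _ h => ⟨h.1.symm, h.2.2, h.2.1⟩⟩
  loopless := ⟨fun _ h => h.1 rfl⟩

/-- The configuration in which exactly the layers up to `t` defect. -/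
def layerConfig {V : Type*} (L : V → ℕ) (t : ℕ) (v : V) : Strategy :=
  if L v ≤ t then Strategy.D else Strategy.C

theorem mem_closedNbhd_layer {V : Type*} [Fintype V] (L : V → ℕ) (u v : V) :
    u ∈ closedNbhd (layerGraph L) v ↔ L u ≤ L v + 1 ∧ L v ≤ L u + 1 := by
  have h0 : u ∈ closedNbhd (layerGraph L) v ↔
      u = v ∨ (u ≠ v ∧ L u ≤ L v + 1 ∧ L v ≤ L u + 1) := by
    unfold closedNbhd
    rw [Finset.mem_filter]
    exact ⟨fun h => h.2, fun h => ⟨Finset.mem_univ _, h⟩⟩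
  rw [h0]
  by_cases h : u = v
  · subst h; simp
  · simp [h]

theorem layerConfig_eq_D {V : Type*} (L : V → ℕ) (t : ℕ) (v : V) :
    layerConfig L t v = Strategy.D ↔ L v ≤ t := by
  unfold layerConfig; split_ifs <;> simp_all

theorem layerConfig_eq_C {V : Type*} (L : V → ℕ) (t : ℕ) (v : V) :
    layerConfig L t v = Strategy.C ↔ t < L v := by
  unfold layerConfig; split_ifs <;> simp_all

/-- A defector that beats all collaborators of a closed neighbourhood forces defection. -/
theorem step_eq_D {V : Type*} [Fintype V] (G : SimpleGraph V) (w : ℝ) (c : V → Strategy) (v : V)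
    (x : V) (hx : x ∈ closedNbhd G v)
    (h : ∀ u ∈ closedNbhd G v, c u = Strategy.C → power G w c u < power G w c x) :
    step G w c v = Strategy.D := by
  obtain ⟨y, hy, hmax⟩ := Finset.exists_max_image (closedNbhd G v) (power G w c) ⟨x, hx⟩
  have key : ∀ u ∈ (closedNbhd G v).filter
      (fun u => ∀ z ∈ closedNbhd G v, power G w c z ≤ power G w c u), c u = Strategy.D := by
    intro u hu
    rw [Finset.mem_filter] at hu
    cases hc : c u with
    | D => rfl
    | C => exact absurd (hu.2 x hx) (not_le.mpr (h u hu.1 hc))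
  have hyM : y ∈ (closedNbhd G v).filter
      (fun u => ∀ z ∈ closedNbhd G v, power G w c z ≤ power G w c u) :=
    Finset.mem_filter.mpr ⟨hy, hmax⟩
  unfold step
  simp only
  rw [if_neg, if_pos key]
  intro hall
  have h1 := hall y hyM
  rw [key y hyM] at h1
  cases h1

theorem step_eq_C {V : Type*} [Fintype V] (G : SimpleGraph V) (w : ℝ) (c : V → Strategy) (v : V)
    (h : ∀ u ∈ closedNbhd G v, c u = Strategy.C) : step G w c v = Strategy.C := by
  unfold step
  simp only
  rw [if_pos]
  intro u hu
  exact h u (Finset.mem_filter.mp hu).1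

/-- Size of layer `j`. -/
def layerSize {V : Type*} [Fintype V] (L : V → ℕ) (j : ℕ) : ℕ :=
  (Finset.univ.filter fun v => L v = j).card

/-- Size of layer `j - 1`, which is `0` when `j = 0`. -/
def prevSize {V : Type*} [Fintype V] (L : V → ℕ) (j : ℕ) : ℕ :=
  (Finset.univ.filter fun v => L v + 1 = j).card

theorem card_nbhd {V : Type*} [Fintype V] (G : SimpleGraph V) (c : V → Strategy) (v : V) :
    (closedNbhd G v).card = ((closedNbhd G v).filter fun u => c u = Strategy.C).card +
      ((closedNbhd G v).filter fun u => c u = Strategy.D).card := by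
  rw [← Finset.card_filter_add_card_filter_not (s := closedNbhd G v)
    (p := fun u => c u = Strategy.C)]
  congr 2
  ext u
  cases hc : c u <;> simp [hc]

theorem power_front {V : Type*} [Fintype V] (L : V → ℕ) (w : ℝ) (hw : 1 / 2 ≤ w) (t : ℕ)
    (h1 : layerSize L (t + 1) ≤ layerSize L t + prevSize L t) (x : V) (hx : L x = t) :
    power (layerGraph L) w (layerConfig L t) x
      = 1 / ((layerSize L t + prevSize L t : ℕ) : ℝ) := by
  have hC : ((closedNbhd (layerGraph L) x).filter
      fun u => layerConfig L t u = Strategy.C).card = layerSize L (t + 1) := by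
    unfold layerSize
    congr 1
    ext u
    simp only [Finset.mem_filter, mem_closedNbhd_layer, layerConfig_eq_C, Finset.mem_univ, true_and]
    omega
  have hD : ((closedNbhd (layerGraph L) x).filter
      fun u => layerConfig L t u = Strategy.D).card = layerSize L t + prevSize L t := by
    unfold layerSize prevSize
    rw [← Finset.card_union_of_disjoint]
    · congr 1
      ext u
      simp only [Finset.mem_filter, mem_closedNbhd_layer, layerConfig_eq_D, Finset.mem_univ,
        true_and, Finset.mem_union]
      omega
    · rw [Finset.disjoint_left]
      intro u
      simp only [Finset.mem_filter, Finset.mem_univ, true_and]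
      omega
  have hN := card_nbhd (layerGraph L) (layerConfig L t) x
  have hcx : layerConfig L t x = Strategy.D := (layerConfig_eq_D L t x).2 hx.le
  have hpos : 0 < layerSize L t := Finset.card_pos.mpr ⟨x, by simp [hx]⟩
  unfold power
  simp only [hcx]
  rw [hN, hC, hD, if_pos]
  refine le_trans ?_ hw
  have h1' : (layerSize L (t + 1) : ℝ) ≤ ((layerSize L t + prevSize L t : ℕ) : ℝ) := by
    exact_mod_cast h1
  have hpos' : (0 : ℝ) < ((layerSize L t + prevSize L t : ℕ) : ℝ) := by
    exact_mod_cast (by omega : 0 < layerSize L t + prevSize L t)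
  have h0 : (0 : ℝ) ≤ (layerSize L (t + 1) : ℝ) := by positivity
  rw [Nat.cast_add (layerSize L (t + 1)), div_le_div_iff₀ (by linarith) (by norm_num)]
  linarith

theorem power_collab {V : Type*} [Fintype V] (L : V → ℕ) (w : ℝ) (hw : 1 / 2 ≤ w) (t : ℕ)
    (hpos : 0 < layerSize L t)
    (h2 : layerSize L t + prevSize L t < layerSize L (t + 1) + layerSize L (t + 2) ∨
      (layerSize L (t + 1) ≤ layerSize L t ∧ layerSize L (t + 2) = 0))
    (u : V) (hu : L u = t + 1 ∨ L u = t + 2) :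
    power (layerGraph L) w (layerConfig L t) u
      < 1 / ((layerSize L t + prevSize L t : ℕ) : ℝ) := by
  have hcu : layerConfig L t u = Strategy.C := (layerConfig_eq_C L t u).2 (by omega)
  have hp : (0 : ℝ) < ((layerSize L t + prevSize L t : ℕ) : ℝ) := by
    exact_mod_cast (by omega : 0 < layerSize L t + prevSize L t)
  have hdisj : Disjoint (Finset.univ.filter fun v => L v = t + 1)
      (Finset.univ.filter fun v => L v = t + 2) := by
    rw [Finset.disjoint_left]
    intro u
    simp only [Finset.mem_filter, Finset.mem_univ, true_and]
    omega
  have hC : layerSize L (t + 1) + layerSize L (t + 2) ≤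
      ((closedNbhd (layerGraph L) u).filter fun u => layerConfig L t u = Strategy.C).card := by
    unfold layerSize
    rw [← Finset.card_union_of_disjoint hdisj]
    apply Finset.card_le_card
    intro y
    simp only [Finset.mem_filter, mem_closedNbhd_layer, layerConfig_eq_C, Finset.mem_univ,
      true_and, Finset.mem_union]
    omega
  have hN := card_nbhd (layerGraph L) (layerConfig L t) u
  unfold power
  simp only [hcu]
  split_ifs with hwin
  · rcases h2 with h2 | ⟨h2, h3⟩
    · apply one_div_lt_one_div_of_lt hp
      exact_mod_cast lt_of_lt_of_le h2 hC
    · exfalso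
      have hempty : ∀ y, L y ≠ t + 2 := by
        intro y hy
        have : 0 < layerSize L (t + 2) := Finset.card_pos.mpr ⟨y, by simp [hy]⟩
        omega
      have hu1 : L u = t + 1 := hu.resolve_right (hempty u)
      have hC' : ((closedNbhd (layerGraph L) u).filter
          fun u => layerConfig L t u = Strategy.C).card = layerSize L (t + 1) := by
        unfold layerSize
        congr 1
        ext y
        have := hempty y
        simp only [Finset.mem_filter, mem_closedNbhd_layer, layerConfig_eq_C, Finset.mem_univ,
          true_and]
        omega
      have hD' : ((closedNbhd (layerGraph L) u).filter
          fun u => layerConfig L t u = Strategy.D).card = layerSize L t := by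
        unfold layerSize
        congr 1
        ext y
        simp only [Finset.mem_filter, mem_closedNbhd_layer, layerConfig_eq_D, Finset.mem_univ,
          true_and]
        omega
      rw [hN, hC', hD'] at hwin
      have h2' : (layerSize L (t + 1) : ℝ) ≤ layerSize L t := by exact_mod_cast h2
      have hpos' : (0 : ℝ) < layerSize L t := by exact_mod_cast hpos
      have h0 : (0 : ℝ) ≤ (layerSize L (t + 1) : ℝ) := by positivity
      have : (layerSize L (t + 1) : ℝ) / ((layerSize L (t + 1) + layerSize L t : ℕ) : ℝ)
          ≤ 1 / 2 := by
        rw [Nat.cast_add, div_le_div_iff₀ (by linarith) (by norm_num)]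
        linarith
      linarith
  · positivity

theorem step_layer {V : Type*} [Fintype V] (L : V → ℕ) (w : ℝ) (hw : 1 / 2 ≤ w) (t : ℕ)
    (hpos : 0 < layerSize L t)
    (h1 : layerSize L (t + 1) ≤ layerSize L t + prevSize L t)
    (h2 : layerSize L t + prevSize L t < layerSize L (t + 1) + layerSize L (t + 2) ∨
      (layerSize L (t + 1) ≤ layerSize L t ∧ layerSize L (t + 2) = 0)) :
    step (layerGraph L) w (layerConfig L t) = layerConfig L (t + 1) := by
  funext v
  by_cases hv : L v ≤ t + 1
  · rw [(layerConfig_eq_D L (t + 1) v).2 hv]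
    by_cases hv' : L v < t
    · refine step_eq_D _ _ _ _ v ((mem_closedNbhd_layer L v v).2 (by omega)) ?_
      intro u hu hc
      rw [mem_closedNbhd_layer] at hu
      rw [layerConfig_eq_C] at hc
      omega
    · obtain ⟨x, hx⟩ := Finset.card_pos.mp hpos
      have hx' : L x = t := by simpa using hx
      refine step_eq_D _ _ _ _ x ((mem_closedNbhd_layer L x v).2 (by omega)) ?_
      intro u hu hc
      rw [mem_closedNbhd_layer] at hu
      rw [layerConfig_eq_C] at hc
      rw [power_front L w hw t h1 x hx']
      exact power_collab L w hw t hpos h2 u (by omega)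
  · rw [(layerConfig_eq_C L (t + 1) v).2 (by omega)]
    apply step_eq_C
    intro u hu
    rw [mem_closedNbhd_layer] at hu
    rw [layerConfig_eq_C]
    omega

/-- The intended size of layer `j`. -/
def wantedSize (n j : ℕ) : ℕ := if j ≤ n + 1 then max 1 (min j n) else 0

theorem dominant_of_sizes {V : Type*} [Fintype V] (L : V → ℕ) (w : ℝ) (hw : 1 / 2 ≤ w) (n : ℕ)
    (hn : 1 ≤ n) (hL : ∀ j, layerSize L j = wantedSize n j) :
    DefectorDominant (layerGraph L) w (layerConfig L 0) := by
  have hseq : ∀ t, t ≤ n + 1 →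
      configSeq (layerGraph L) w (layerConfig L 0) t = layerConfig L t := by
    intro t
    induction t with
    | zero => intro _; rfl
    | succ t ih =>
      intro ht
      have hprev : prevSize L t = if t = 0 then 0 else wantedSize n (t - 1) := by
        split_ifs with h0
        · subst h0; simp [prevSize]
        · rw [← hL]
          unfold prevSize layerSize
          congr 1
          ext y
          simp only [Finset.mem_filter, Finset.mem_univ, true_and]
          omega
      change step _ _ (configSeq _ _ _ t) = _
      rw [ih (by omega)]
      apply step_layer L w hw t
      · rw [hL]; unfold wantedSize; split_ifs <;> omega
      · rw [hprev, hL, hL]; unfold wantedSize; split_ifs <;> omega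
      · rw [hprev, hL, hL, hL]; unfold wantedSize; split_ifs <;> omega
  have hall : ∀ v, L v ≤ n + 1 := by
    intro v
    by_contra hv
    have h1 : 0 < layerSize L (L v) := Finset.card_pos.mpr ⟨v, by simp⟩
    rw [hL, wantedSize, if_neg hv] at h1
    omega
  have hD : ∀ v, layerConfig L (n + 1) v = Strategy.D :=
    fun v => (layerConfig_eq_D L (n + 1) v).2 (hall v)
  refine ⟨n + 1, ?_, ?_⟩
  · change step _ _ (configSeq _ _ _ (n + 1)) = _
    rw [hseq _ le_rfl]
    funext v
    rw [hD v]
    refine step_eq_D _ _ _ _ v ((mem_closedNbhd_layer L v v).2 (by omega)) ?_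
    intro u _ hc
    rw [hD u] at hc
    cases hc
  · intro v
    rw [hseq _ le_rfl]
    exact hD v

/-- Nonempty examples: at least `n + 2` vertices, exactly one initial defector. -/
theorem exists_layered (w : ℝ) (hw : 1 / 2 ≤ w) (n : ℕ) (hn : 1 ≤ n) :
    ∃ (m : ℕ) (G : SimpleGraph (Fin m)) (c0 : Fin m → Strategy), n + 2 ≤ m ∧
      (Finset.univ.filter fun v => c0 v = Strategy.D).card = 1 ∧ DefectorDominant G w c0 := by
  let V := Σ j : Fin (n + 2), Fin (wantedSize n j)
  let e : V ≃ Fin (Fintype.card V) := Fintype.equivFin V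
  let L : Fin (Fintype.card V) → ℕ := fun x => ((e.symm x).1 : ℕ)
  have hL : ∀ j, layerSize L j = wantedSize n j := by
    intro j
    by_cases hj : j < n + 2
    · have h1 : (Finset.univ.filter fun x => L x = j) =
          (Finset.univ : Finset (Fin (wantedSize n j))).image
            (fun i => e ⟨(⟨j, hj⟩ : Fin (n + 2)), i⟩) := by
        ext x
        simp only [Finset.mem_filter, Finset.mem_univ, true_and, Finset.mem_image]
        constructor
        · intro hx
          obtain ⟨⟨⟨k, hk⟩, i⟩, rfl⟩ := e.surjective x
          have : k = j := by simpa [L] using hx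
          subst this
          exact ⟨i, rfl⟩
        · rintro ⟨i, rfl⟩
          simp [L]
      unfold layerSize
      rw [h1, Finset.card_image_of_injective]
      · simp
      · intro a b hab
        have h3 := e.injective hab
        exact eq_of_heq (Sigma.mk.inj h3).2
    · unfold layerSize wantedSize
      rw [if_neg (by omega), Finset.card_eq_zero, Finset.filter_eq_empty_iff]
      intro x _ hx
      have := (e.symm x).1.isLt
      have hx' : ((e.symm x).1 : ℕ) = j := hx
      omega
  refine ⟨Fintype.card V, layerGraph L, layerConfig L 0, ?_, ?_, dominant_of_sizes L w hw n hn hL⟩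
  · have hinj : Function.Injective
        (fun j : Fin (n + 2) => (⟨j, ⟨0, by unfold wantedSize; split_ifs <;> omega⟩⟩ : V)) := by
      intro a b hab
      exact congrArg (fun v : V => v.1) hab
    have hc := Fintype.card_le_of_injective _ hinj
    rwa [Fintype.card_fin] at hc
  · have h0 := hL 0
    unfold layerSize at h0
    simp only [layerConfig_eq_D, Nat.le_zero]
    rw [h0]
    simp [wantedSize]

/-- For every `ε > 0` and every win condition `w ∈ [1/2, 1)` there
exist a finite simple graph and an initial configuration in which the proportion of
defectors is less than `ε` and which is defector dominant for the
`w`-power index process. -/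
theorem statement3 (ε : ℝ) (hε : 0 < ε) (w : ℝ) (hw1 : 1 / 2 ≤ w) (hw2 : w < 1) :
    ∃ (m : ℕ) (G : SimpleGraph (Fin m)) (c0 : Fin m → Strategy),
      ((Finset.univ.filter fun v => c0 v = Strategy.D).card : ℝ) / (m : ℝ) < ε ∧
      DefectorDominant G w c0 := by
  obtain ⟨k, hk⟩ := exists_nat_one_div_lt hε
  obtain ⟨m, G, c0, hm, hcard, hdom⟩ := exists_layered w hw1 (k + 1) (by omega)
  refine ⟨m, G, c0, ?_, hdom⟩
  rw [hcard]
  refine lt_of_le_of_lt ?_ hk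
  rw [Nat.cast_one]
  apply one_div_le_one_div_of_le (by positivity)
  exact_mod_cast (by omega : k + 1 ≤ m)
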